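/- Let (u_1,…,u_r) and (ũ_1,…,ũ_r) be r-tuples in R with both ∏_{i>j}(u_i − u_j) and ∏_{i>j}(ũ_i − ũ_j) invertible in R. Then there is an R-algebra isomorphism H_{n,r}(R, q, ũ_1,…,ũ_r) → H_{n,r}(R, q, u_1,…,u_r) sending T̃_j ↦ T_j and t̃_i ↦ Σ_{(k_1,…,k_n) ∈ [1,r]^n} ũ_{k_i}·b_{k_1,…,k_n} = Σ_{j=0}^{r−1} a_j·t_i^j, where a_0,…,a_{r−1} ∈ R are the unique solution of the linear system Σ_{j=0}^{r−1} a_j·u_c^j = ũ_c for 1 ≤ c ≤ r (given by the transpose of the Vandermonde matrix of u_1,…,u_r). In particular, H_{n,r}(R, q, u_1,…,u_r) and H_{n,r}(R, q, ũ_1,…,ũ_r) are isomorphic R-algebras. -/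

import Mathlib

open Polynomial

namespace MAK

noncomputable section

variable (R : Type*) [CommRing R] (n r : ℕ) (q Δ : Rˣ) (u : Fin r → R) (F : Fin r → R[X])

/-- The free `R`-algebra on generators `t_1, …, t_n` (left) and `T_1, …, T_{n-1}` (right). -/
abbrev FA := FreeAlgebra R (Fin n ⊕ Fin (n - 1))

/-- The generators `t_i`. -/
def tf (i : Fin n) : FA R n := FreeAlgebra.ι R (Sum.inl i)

/-- The generators `T_j`. -/
def Tf (j : Fin (n - 1)) : FA R n := FreeAlgebra.ι R (Sum.inr j)

/-- The index `j`, viewed in `Fin n`. -/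
def lo (j : Fin (n - 1)) : Fin n := ⟨j.1, by have := j.2; omega⟩

/-- The index `j + 1`, viewed in `Fin n`. -/
def hi (j : Fin (n - 1)) : Fin n := ⟨j.1 + 1, by have := j.2; omega⟩

/-- The element `B_j = Δ⁻² Σ_{c1<c2} (u_{c2} - u_{c1})(q - q⁻¹) F_{c1}(t_j) F_{c2}(t_{j+1})`. -/
def Bel (j : Fin (n - 1)) : FA R n :=
  ∑ c2 : Fin r, ∑ c1 ∈ Finset.univ.filter (fun c1 => c1 < c2),
    (((Δ⁻¹ : Rˣ) : R) ^ 2 * ((u c2 - u c1) * ((q : R) - ((q⁻¹ : Rˣ) : R)))) •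
      (aeval (tf R n (lo n j)) (F c1) * aeval (tf R n (hi n j)) (F c2))

/-- The defining relations of the modified Ariki-Koike algebra. -/
inductive Rel : FA R n → FA R n → Prop
  | quad (j : Fin (n - 1)) :
      Rel ((Tf R n j - algebraMap R (FA R n) (q : R)) *
        (Tf R n j + algebraMap R (FA R n) ((q⁻¹ : Rˣ) : R))) 0
  | tord (i : Fin n) : Rel (aeval (tf R n i) (∏ c : Fin r, (X - C (u c)))) 0
  | braid (j k : Fin (n - 1)) (h : k.1 = j.1 + 1) :
      Rel (Tf R n j * Tf R n k * Tf R n j) (Tf R n k * Tf R n j * Tf R n k)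
  | Tcomm (j k : Fin (n - 1)) (h : j.1 + 2 ≤ k.1 ∨ k.1 + 2 ≤ j.1) :
      Rel (Tf R n j * Tf R n k) (Tf R n k * Tf R n j)
  | tcomm (i i' : Fin n) : Rel (tf R n i * tf R n i') (tf R n i' * tf R n i)
  | Tt (j : Fin (n - 1)) (i : Fin n) (h1 : i ≠ lo n j) (h2 : i ≠ hi n j) :
      Rel (Tf R n j * tf R n i) (tf R n i * Tf R n j)
  | Thi (j : Fin (n - 1)) :
      Rel (Tf R n j * tf R n (hi n j)) (tf R n (lo n j) * Tf R n j + Bel R n r q Δ u F j)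
  | Tlo (j : Fin (n - 1)) :
      Rel (Tf R n j * tf R n (lo n j)) (tf R n (hi n j) * Tf R n j - Bel R n r q Δ u F j)

/-- The modified Ariki-Koike algebra `H_{n,r}(R, q, u_1, …, u_r)`. -/
abbrev Hnr := RingQuot (Rel R n r q Δ u F)

/-- The canonical projection. -/
def pim : FA R n →ₐ[R] Hnr R n r q Δ u F := RingQuot.mkAlgHom R (Rel R n r q Δ u F)

/-- The generator `t_i` of `H_{n,r}`. -/
def tt (i : Fin n) : Hnr R n r q Δ u F := pim R n r q Δ u F (tf R n i)

/-- The generator `T_j` of `H_{n,r}`. -/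
def TT (j : Fin (n - 1)) : Hnr R n r q Δ u F := pim R n r q Δ u F (Tf R n j)

/-- The Lagrange basis polynomial `∏_{j ≠ c} (X - u_j)/(u_c - u_j)`. -/
def bpoly (c : Fin r) : R[X] :=
  ∏ j ∈ Finset.univ.filter (fun j => j ≠ c), Ring.inverse (u c - u j) • (X - C (u j))

/-- The idempotent `b_{k_1, …, k_n}`. -/
def b (k : Fin n → Fin r) : Hnr R n r q Δ u F :=
  (List.ofFn fun i : Fin n => aeval (tt R n r q Δ u F i) (bpoly R r u (k i))).prod

/-- The element `B'_{i,j} = -(q - q⁻¹) Σ_{k_i < k_j} b_{k_1, …, k_n}`. -/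
def B' (i j : Fin n) : Hnr R n r q Δ u F :=
  -(((q : R) - ((q⁻¹ : Rˣ) : R)) •
    ∑ k ∈ Finset.univ.filter (fun k : Fin n → Fin r => k i < k j), b R n r q Δ u F k)

/-- The element `g_i := T_i + B'_{i,i+1}`. -/
def g (j : Fin (n - 1)) : Hnr R n r q Δ u F :=
  TT R n r q Δ u F j + B' R n r q Δ u F (lo n j) (hi n j)

/-- The idempotent `e_{i,j} = Σ_{k_i = k_j} b_{k_1, …, k_n}`. -/
def eij (i j : Fin n) : Hnr R n r q Δ u F :=
  ∑ k ∈ Finset.univ.filter (fun k : Fin n → Fin r => k i = k j), b R n r q Δ u F k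

/-- The idempotent `e_i = e_{i,i+1}`. -/
def ee (j : Fin (n - 1)) : Hnr R n r q Δ u F := eij R n r q Δ u F (lo n j) (hi n j)

/-- The simple transposition `s_j = (j, j+1)` in `S_n`. -/
def simple (j : Fin (n - 1)) : Equiv.Perm (Fin n) := Equiv.swap (lo n j) (hi n j)

/-- `l` is a reduced word for the permutation `w`. -/
def IsReducedWord (w : Equiv.Perm (Fin n)) (l : List (Fin (n - 1))) : Prop :=
  (l.map (simple n)).prod = w ∧
    ∀ l' : List (Fin (n - 1)), (l'.map (simple n)).prod = w → l.length ≤ l'.length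

/-- The element `g_w = g_{i_1} ⋯ g_{i_l}` associated to a word `l = (i_1, …, i_l)`. -/
def gword (l : List (Fin (n - 1))) : Hnr R n r q Δ u F := (l.map (g R n r q Δ u F)).prod

/-- The element `T_w = T_{i_1} ⋯ T_{i_l}` associated to a word `l = (i_1, …, i_l)`. -/
def Tword (l : List (Fin (n - 1))) : Hnr R n r q Δ u F := (l.map (TT R n r q Δ u F)).prod

/-- The monomial `t_1^{c_1} ⋯ t_n^{c_n}`. -/
def tmon (c : Fin n → ℕ) : Hnr R n r q Δ u F :=
  (List.ofFn fun i : Fin n => tt R n r q Δ u F i ^ c i).prod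

end

end MAK

open MAK

namespace MAK

section Interpolation

variable {R : Type*} [CommRing R] {r : ℕ} {u : Fin r → R}

theorem isUnit_sub_of_eval {Δ : Rˣ} {F : Fin r → R[X]}
    (hF : ∀ c c' : Fin r, (F c).eval (u c') = if c' = c then (Δ : R) else 0)
    {c c' : Fin r} (h : c' ≠ c) : IsUnit (u c - u c') := by
  have hdvd := (F c).sub_dvd_eval_sub (u c) (u c')
  rw [hF, hF, if_pos rfl, if_neg h, sub_zero] at hdvd
  exact isUnit_of_dvd_unit hdvd Δ.isUnit

theorem eval_bpoly (hu : ∀ c c' : Fin r, c' ≠ c → IsUnit (u c - u c')) (c c' : Fin r) :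
    (bpoly R r u c).eval (u c') = if c' = c then 1 else 0 := by
  rw [bpoly, eval_prod]
  split_ifs with h
  · subst h
    refine Finset.prod_eq_one fun j hj => ?_
    simp [Ring.inverse_mul_cancel _ (hu _ _ (Finset.mem_filter.1 hj).2)]
  · exact Finset.prod_eq_zero (i := c') (by simp [h]) (by simp)

theorem eval_sum_smul_bpoly (hu : ∀ c c' : Fin r, c' ≠ c → IsUnit (u c - u c'))
    (w : Fin r → R) (c : Fin r) : (∑ k, w k • bpoly R r u k).eval (u c) = w c := by
  simp [eval_finsetSum, eval_bpoly hu]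

variable {A : Type*} [Ring A] [Algebra R A]

theorem aeval_eq_of_eval_eq (hu : ∀ c c' : Fin r, c' ≠ c → IsUnit (u c - u c')) {x : A}
    (hx : aeval x (∏ c : Fin r, (X - C (u c))) = 0) {f g : R[X]}
    (h : ∀ c, f.eval (u c) = g.eval (u c)) : aeval x f = aeval x g := by
  have hdvd : (∏ c : Fin r, (X - C (u c))) ∣ f - g := by
    refine Finset.prod_dvd_of_coprime (fun c _ c' _ h => ?_) fun c _ => ?_
    · exact isCoprime_X_sub_C_of_isUnit_sub (hu c c' h.symm)
    · rw [dvd_iff_isRoot, IsRoot, eval_sub, h, sub_self]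
  obtain ⟨k, hk⟩ := hdvd
  rw [← sub_eq_zero, ← map_sub, hk, map_mul, hx, zero_mul]

/-- The commutation rule `T y = x T + δ ∑ (u_{c2} - u_{c1}) e_{c1} d_{c2}` propagates to all
polynomials. -/
theorem mul_aeval_of_add {x y T : A} {δ : R} {e d : Fin r → A}
    (he : ∀ (f : R[X]) c, aeval x f * e c = f.eval (u c) • e c)
    (hd : ∀ c, d c * y = u c • d c)
    (hT : T * y = x * T + δ • ∑ c2, ∑ c1 ∈ Finset.univ.filter (fun c1 => c1 < c2),
      (u c2 - u c1) • (e c1 * d c2)) (f : R[X]) :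
    T * aeval y f = aeval x f * T + δ • ∑ c2, ∑ c1 ∈ Finset.univ.filter (fun c1 => c1 < c2),
      (f.eval (u c2) - f.eval (u c1)) • (e c1 * d c2) := by
  induction f using Polynomial.induction_on with
  | C a => simp [Algebra.commutes]
  | add f g hf hg =>
    simp only [map_add, mul_add, add_mul, hf, hg, eval_add]
    rw [add_add_add_comm, ← smul_add]
    simp only [← Finset.sum_add_distrib, ← add_smul, add_sub_add_comm]
  | monomial k a ih =>
    rw [pow_succ, ← mul_assoc]
    generalize C a * X ^ k = f at ih
    rw [map_mul, map_mul, aeval_X, aeval_X, ← mul_assoc, ih, add_mul, mul_assoc _ T, hT, mul_add,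
      ← mul_assoc, add_assoc, mul_smul_comm, smul_mul_assoc, ← smul_add]
    simp only [Finset.mul_sum, Finset.sum_mul, ← Finset.sum_add_distrib]
    congr 2
    refine Finset.sum_congr rfl fun c2 _ => Finset.sum_congr rfl fun c1 _ => ?_
    rw [mul_smul_comm, smul_mul_assoc, ← mul_assoc, he, mul_assoc, hd, smul_mul_assoc,
      mul_smul_comm, smul_smul, smul_smul, ← add_smul, eval_mul, eval_mul, eval_X, eval_X]
    congr 1
    ring

/-- The commutation rule `T x = y T - δ ∑ (u_{c2} - u_{c1}) e_{c1} d_{c2}` propagates to all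
polynomials. -/
theorem mul_aeval_of_sub {x y T : A} {δ : R} {e d : Fin r → A}
    (he : ∀ c, e c * x = u c • e c)
    (hd : ∀ (f : R[X]) c, aeval y f * d c = f.eval (u c) • d c)
    (hed : ∀ c c', e c * d c' = d c' * e c)
    (hT : T * x = y * T - δ • ∑ c2, ∑ c1 ∈ Finset.univ.filter (fun c1 => c1 < c2),
      (u c2 - u c1) • (e c1 * d c2)) (f : R[X]) :
    T * aeval x f = aeval y f * T - δ • ∑ c2, ∑ c1 ∈ Finset.univ.filter (fun c1 => c1 < c2),
      (f.eval (u c2) - f.eval (u c1)) • (e c1 * d c2) := by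
  induction f using Polynomial.induction_on with
  | C a => simp [Algebra.commutes]
  | add f g hf hg =>
    simp only [map_add, mul_add, add_mul, hf, hg, eval_add]
    rw [sub_add_sub_comm, ← smul_add]
    simp only [← Finset.sum_add_distrib, ← add_smul, add_sub_add_comm]
  | monomial k a ih =>
    rw [pow_succ, ← mul_assoc]
    generalize C a * X ^ k = f at ih
    rw [map_mul, map_mul, aeval_X, aeval_X, ← mul_assoc, ih, sub_mul, mul_assoc _ T, hT, mul_sub,
      ← mul_assoc, sub_sub, mul_smul_comm, smul_mul_assoc, ← smul_add]
    simp only [Finset.mul_sum, Finset.sum_mul, ← Finset.sum_add_distrib]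
    congr 2
    refine Finset.sum_congr rfl fun c2 _ => Finset.sum_congr rfl fun c1 _ => ?_
    rw [mul_smul_comm, smul_mul_assoc, hed, ← mul_assoc, hd, mul_assoc, he, smul_mul_assoc,
      mul_smul_comm, smul_smul, smul_smul, ← add_smul, eval_mul, eval_mul, eval_X, eval_X]
    congr 1
    ring

theorem map_Bel {n : ℕ} (q Δ : Rˣ) (F : Fin r → R[X]) (ψ : FA R n →ₐ[R] A) (j : Fin (n - 1))
    {e d : Fin r → A} (he : ∀ c, aeval (ψ (tf R n (lo n j))) (F c) = (Δ : R) • e c)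
    (hd : ∀ c, aeval (ψ (tf R n (hi n j))) (F c) = (Δ : R) • d c) :
    ψ (Bel R n r q Δ u F j) = ((q : R) - ((q⁻¹ : Rˣ) : R)) •
      ∑ c2, ∑ c1 ∈ Finset.univ.filter (fun c1 => c1 < c2), (u c2 - u c1) • (e c1 * d c2) := by
  simp only [Bel, map_sum, map_smul, map_mul, ← aeval_algHom_apply, he, hd, Finset.smul_sum]
  refine Finset.sum_congr rfl fun c2 _ => Finset.sum_congr rfl fun c1 _ => ?_
  rw [smul_mul_smul_comm, smul_smul, smul_smul]
  congr 1
  linear_combination ((q : R) - ((q⁻¹ : Rˣ) : R)) * (u c2 - u c1) *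
    (1 + ((Δ⁻¹ : Rˣ) : R) * Δ) * Δ.inv_mul

end Interpolation

section Presentation

variable {R : Type*} [CommRing R] {n r : ℕ} {q Δ Δ' : Rˣ} {u u' : Fin r → R}
  {F F' : Fin r → R[X]}

theorem pim_eq_of_rel {a a' : FA R n} (h : Rel R n r q Δ u F a a') :
    pim R n r q Δ u F a = pim R n r q Δ u F a' :=
  RingQuot.mkAlgHom_rel R h

theorem aeval_tt_prod (i : Fin n) :
    aeval (tt R n r q Δ u F i) (∏ c : Fin r, (X - C (u c))) = 0 := by
  rw [tt, aeval_algHom_apply, pim_eq_of_rel (Rel.tord i), map_zero]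

theorem commute_tt (i i' : Fin n) : Commute (tt R n r q Δ u F i) (tt R n r q Δ u F i') := by
  rw [Commute, SemiconjBy, tt, tt, ← map_mul, pim_eq_of_rel (Rel.tcomm i i'), map_mul]

theorem commute_aeval {A : Type*} [Ring A] [Algebra R A] {x y : A} (h : Commute x y)
    (f : R[X]) : Commute x (aeval y f) := by
  induction f using Polynomial.induction_on' with
  | add f g hf hg => rw [map_add]; exact hf.add_right hg
  | monomial k a =>
    rw [aeval_monomial]
    exact (Algebra.commute_algebraMap_right a x).mul_right (h.pow_right k)

theorem algHom_ext_of_generators {A : Type*} [Ring A] [Algebra R A]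
    {φ ψ : Hnr R n r q Δ u F →ₐ[R] A}
    (ht : ∀ i, φ (tt R n r q Δ u F i) = ψ (tt R n r q Δ u F i))
    (hT : ∀ j, φ (TT R n r q Δ u F j) = ψ (TT R n r q Δ u F j)) : φ = ψ := by
  apply RingQuot.ringQuot_ext'
  apply FreeAlgebra.hom_ext
  funext s
  rcases s with i | j
  · exact ht i
  · exact hT j

/-- A polynomial taking the value `u'_c` at `u_c` for all `c` induces a homomorphism
`H_{n,r}(R, q, u') → H_{n,r}(R, q, u)` fixing the `T_j`. -/
theorem exists_algHom_of_eval
    (hF : ∀ c c' : Fin r, (F c).eval (u c') = if c' = c then (Δ : R) else 0)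
    (hF' : ∀ c c' : Fin r, (F' c).eval (u' c') = if c' = c then (Δ' : R) else 0)
    (hu : ∀ c c' : Fin r, c' ≠ c → IsUnit (u c - u c'))
    {f : R[X]} (hf : ∀ c, f.eval (u c) = u' c) :
    ∃ φ : Hnr R n r q Δ' u' F' →ₐ[R] Hnr R n r q Δ u F,
      (∀ j, φ (TT R n r q Δ' u' F' j) = TT R n r q Δ u F j) ∧
      ∀ i, φ (tt R n r q Δ' u' F' i) = aeval (tt R n r q Δ u F i) f := by
  set t := tt R n r q Δ u F with ht
  set T := TT R n r q Δ u F with hT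
  set e : Fin n → Fin r → Hnr R n r q Δ u F := fun i c => aeval (t i) (bpoly R r u c) with he
  have hval : ∀ (i : Fin n) {f g : R[X]}, (∀ c, f.eval (u c) = g.eval (u c)) →
      aeval (t i) f = aeval (t i) g := fun i _ _ h =>
    aeval_eq_of_eval_eq hu (aeval_tt_prod i) h
  have hmul : ∀ i (f : R[X]) c, aeval (t i) f * e i c = f.eval (u c) • e i c := by
    intro i f c
    rw [he, ← map_mul, ← map_smul]
    refine hval i fun c' => ?_
    rw [eval_mul, eval_smul, eval_bpoly hu, smul_eq_mul]
    split_ifs with h <;> simp [h]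
  have hmul' : ∀ i c, e i c * t i = u c • e i c := by
    intro i c
    have := hmul i X c
    rw [aeval_X, eval_X] at this
    rw [← this]
    exact ((commute_aeval (Commute.refl (t i)) _).eq).symm
  have hcomm : ∀ i i' (f g : R[X]), Commute (aeval (t i) f) (aeval (t i') g) := fun i i' f g =>
    commute_aeval (commute_aeval (commute_tt i' i) f).symm g
  have hBel : ∀ j, pim R n r q Δ u F (Bel R n r q Δ u F j) = _ := fun j =>
    map_Bel (u := u) q Δ F (pim R n r q Δ u F) j (e := e (lo n j)) (d := e (hi n j))
      (fun c => by
        rw [he, ← map_smul]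
        refine hval _ fun c' => ?_
        rw [hF, eval_smul, eval_bpoly hu]
        simp)
      (fun c => by
        rw [he, ← map_smul]
        refine hval _ fun c' => ?_
        rw [hF, eval_smul, eval_bpoly hu]
        simp)
  set ψ : FA R n →ₐ[R] Hnr R n r q Δ u F :=
    FreeAlgebra.lift R (Sum.elim (fun i => aeval (t i) f) T) with hψ
  have hψt : ∀ i, ψ (tf R n i) = aeval (t i) f := fun i => by simp [hψ, tf]
  have hψT : ∀ j, ψ (Tf R n j) = T j := fun j => by simp [hψ, Tf]
  have hBel' : ∀ j, ψ (Bel R n r q Δ' u' F' j) = _ := fun j =>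
    map_Bel (u := u') q Δ' F' ψ j (e := e (lo n j)) (d := e (hi n j))
      (fun c => by
        rw [hψt, he, ← map_smul, ← aeval_comp]
        refine hval _ fun c' => ?_
        rw [eval_comp, hf, hF', eval_smul, eval_bpoly hu]
        simp)
      (fun c => by
        rw [hψt, he, ← map_smul, ← aeval_comp]
        refine hval _ fun c' => ?_
        rw [eval_comp, hf, hF', eval_smul, eval_bpoly hu]
        simp)
  have hrel : ∀ ⦃a a' : FA R n⦄, Rel R n r q Δ' u' F' a a' → ψ a = ψ a' := by
    intro a a' h
    cases h with
    | quad j =>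
      have := pim_eq_of_rel (Rel.quad (Δ := Δ) (u := u) (F := F) (q := q) j)
      simpa [hψT, hT, TT] using this
    | tord i =>
      rw [← aeval_algHom_apply, hψt, ← aeval_comp, map_zero]
      rw [hval i (g := 0), map_zero]
      intro c
      rw [eval_comp, hf, eval_prod, eval_zero]
      exact Finset.prod_eq_zero (Finset.mem_univ c) (by simp)
    | braid j k h =>
      have := pim_eq_of_rel (Rel.braid (Δ := Δ) (u := u) (F := F) (q := q) j k h)
      simpa [hψT, hT, TT] using this
    | Tcomm j k h =>
      have := pim_eq_of_rel (Rel.Tcomm (Δ := Δ) (u := u) (F := F) (q := q) j k h)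
      simpa [hψT, hT, TT] using this
    | tcomm i i' =>
      rw [map_mul, map_mul, hψt, hψt]
      exact hcomm i i' f f
    | Tt j i h1 h2 =>
      have := pim_eq_of_rel (Rel.Tt (Δ := Δ) (u := u) (F := F) (q := q) j i h1 h2)
      rw [map_mul, map_mul] at this
      rw [map_mul, map_mul, hψt, hψT]
      exact commute_aeval this f
    | Thi j =>
      have := pim_eq_of_rel (Rel.Thi (Δ := Δ) (u := u) (F := F) (q := q) j)
      rw [map_add, map_mul, map_mul, hBel] at this
      rw [map_add, map_mul, map_mul, hψt, hψt, hψT, hBel']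
      simp only [← hf]
      exact mul_aeval_of_add (hmul _) (hmul' _) this f
    | Tlo j =>
      have := pim_eq_of_rel (Rel.Tlo (Δ := Δ) (u := u) (F := F) (q := q) j)
      rw [map_sub, map_mul, map_mul, hBel] at this
      rw [map_sub, map_mul, map_mul, hψt, hψt, hψT, hBel']
      simp only [← hf]
      exact mul_aeval_of_sub (hmul' _) (hmul _) (fun c c' => hcomm _ _ _ _) this f
  refine ⟨RingQuot.liftAlgHom R ⟨ψ, hrel⟩, fun j => ?_, fun i => ?_⟩
  · rw [TT, pim, RingQuot.liftAlgHom_mkAlgHom_apply, hψT]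
  · rw [tt, pim, RingQuot.liftAlgHom_mkAlgHom_apply, hψt]

theorem sum_smul_b (hu : ∀ c c' : Fin r, c' ≠ c → IsUnit (u c - u c'))
    (w : Fin r → R) (i : Fin n) :
    ∑ k : Fin n → Fin r, w (k i) • b R n r q Δ u F k =
      aeval (tt R n r q Δ u F i) (∑ c, w c • bpoly R r u c) := by
  set t := tt R n r q Δ u F
  let G : (i' : Fin n) → Fin r → Hnr R n r q Δ u F := fun i' c =>
    (if i' = i then w c else 1) • aeval (t i') (bpoly R r u c)
  have hterm : ∀ k : Fin n → Fin r, w (k i) • b R n r q Δ u F k =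
      MultilinearMap.mkPiAlgebraFin R n (Hnr R n r q Δ u F) fun i' => G i' (k i') := by
    intro k
    simp only [G]
    rw [MultilinearMap.map_smul_univ (MultilinearMap.mkPiAlgebraFin R n (Hnr R n r q Δ u F))
      (fun i' => if i' = i then w (k i') else 1), MultilinearMap.mkPiAlgebraFin_apply]
    simp [b, t]
  have hone : ∀ i', i' ≠ i → ∑ c, G i' c = 1 := by
    intro i' h
    simp only [G, if_neg h, one_smul]
    rw [← map_sum, ← map_one (aeval (R := R) (t i'))]
    refine aeval_eq_of_eval_eq hu (aeval_tt_prod i') fun c => ?_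
    simpa using eval_sum_smul_bpoly hu (fun _ => 1) c
  rw [Finset.sum_congr rfl fun k _ => hterm k, ← MultilinearMap.map_sum,
    MultilinearMap.mkPiAlgebraFin_apply, List.ofFn_eq_map,
    List.prod_map_eq_pow_single i _ fun i' h _ => hone i' h,
    List.count_eq_one_of_mem (List.nodup_finRange n) (List.mem_finRange i), pow_one]
  simp [G, t]

end Presentation

end MAK

/-- Corollary 3.14: the algebras `H_{n,r}(R,q,ũ_1,…,ũ_r)` and
`H_{n,r}(R,q,u_1,…,u_r)` are isomorphic. -/
theorem statement12
    (R : Type*) [CommRing R] [IsDomain R] (n r : ℕ) (hn : 1 ≤ n) (hr : 1 ≤ r)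
    (q Δ Δ' : Rˣ) (u u' : Fin r → R) (F F' : Fin r → R[X])
    (hΔ : (Δ : R) = ∏ i : Fin r, ∏ j ∈ Finset.univ.filter (fun j => j < i), (u i - u j))
    (hΔ' : (Δ' : R) = ∏ i : Fin r, ∏ j ∈ Finset.univ.filter (fun j => j < i), (u' i - u' j))
    (hFdeg : ∀ c : Fin r, (F c).degree = ((r - 1 : ℕ) : WithBot ℕ))
    (hFeval : ∀ c c' : Fin r, (F c).eval (u c') = if c' = c then (Δ : R) else 0)
    (hF'deg : ∀ c : Fin r, (F' c).degree = ((r - 1 : ℕ) : WithBot ℕ))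
    (hF'eval : ∀ c c' : Fin r, (F' c).eval (u' c') = if c' = c then (Δ' : R) else 0) :
    ∃ φ : Hnr R n r q Δ' u' F' ≃ₐ[R] Hnr R n r q Δ u F,
      (∀ j : Fin (n - 1), φ (TT R n r q Δ' u' F' j) = TT R n r q Δ u F j) ∧
      (∀ i : Fin n,
        φ (tt R n r q Δ' u' F' i) = ∑ k : Fin n → Fin r, u' (k i) • b R n r q Δ u F k) ∧
      (∀ a : Fin r → R, (∀ c : Fin r, (∑ j : Fin r, a j * u c ^ (j : ℕ)) = u' c) →
        ∀ i : Fin n, φ (tt R n r q Δ' u' F' i) = ∑ j : Fin r, a j • tt R n r q Δ u F i ^ (j : ℕ)) := by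
  have hu := fun c c' (h : c' ≠ c) => isUnit_sub_of_eval hFeval h
  have hu' := fun c c' (h : c' ≠ c) => isUnit_sub_of_eval hF'eval h
  have hf := eval_sum_smul_bpoly hu u'
  have hf' := eval_sum_smul_bpoly hu' u
  set f := ∑ k, u' k • bpoly R r u k
  set f' := ∑ k, u k • bpoly R r u' k
  obtain ⟨φ, hφT, hφt⟩ := exists_algHom_of_eval (n := n) (q := q) hFeval hF'eval hu hf
  obtain ⟨ψ, hψT, hψt⟩ := exists_algHom_of_eval (n := n) (q := q) hF'eval hFeval hu' hf'
  refine ⟨AlgEquiv.ofAlgHom φ ψ ?_ ?_, hφT, fun i => ?_, fun a ha i => ?_⟩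
  · refine algHom_ext_of_generators (fun i => ?_) fun j => ?_
    · rw [AlgHom.comp_apply, hψt, ← aeval_algHom_apply, hφt, ← aeval_comp, AlgHom.id_apply]
      conv_rhs => rw [← aeval_X (R := R) (tt R n r q Δ u F i)]
      refine aeval_eq_of_eval_eq hu (aeval_tt_prod i) fun c => ?_
      rw [eval_comp, hf, hf', eval_X]
    · rw [AlgHom.comp_apply, hψT, hφT, AlgHom.id_apply]
  · refine algHom_ext_of_generators (fun i => ?_) fun j => ?_
    · rw [AlgHom.comp_apply, hφt, ← aeval_algHom_apply, hψt, ← aeval_comp, AlgHom.id_apply]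
      conv_rhs => rw [← aeval_X (R := R) (tt R n r q Δ' u' F' i)]
      refine aeval_eq_of_eval_eq hu' (aeval_tt_prod i) fun c => ?_
      rw [eval_comp, hf', hf, eval_X]
    · rw [AlgHom.comp_apply, hφT, hψT, AlgHom.id_apply]
  · rw [sum_smul_b hu]
    exact hφt i
  · have hsum : ∑ j : Fin r, a j • tt R n r q Δ u F i ^ (j : ℕ) =
        aeval (tt R n r q Δ u F i) (∑ j : Fin r, a j • (X : R[X]) ^ (j : ℕ)) := by
      simp
    rw [hsum]
    refine (hφt i).trans (aeval_eq_of_eval_eq hu (aeval_tt_prod i) fun c => ?_)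
    rw [hf, ← ha c]
    simp [eval_finsetSum]
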